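/- arXiv:0909.0875 — 5 statements merged into one kernel-verified Lean document; each statement's English description precedes it below -/
import Mathlib

section
/- Let U ⊆ ℝ^d be open, let F be smooth on U, and set π_i(x) = x_i for i = 1,…,d and π_{d+1} = F. Then for every admissible differential operator L of type (α,β) with (α,β) ≠ (1,(0,…,0)), there exists a d-tree G on d+1 indices such that either ∂^Gπ = LF on U or ∂^Gπ = −LF on U, and moreover #G = |β|+1−α, G^{(d+1)} = α, and G^{(i)} = |β|+1−α−β_i for every i = 1,…,d (in particular β_i ≤ |β|+1−α for all i). -/
open MeasureTheory
open scoped ENNReal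

/-- The partial derivative `∂/∂x_i` of a scalar function on `ℝ^d`. -/
noncomputable def pderiv' {d : ℕ} (i : Fin d) (f : (Fin d → ℝ) → ℝ) : (Fin d → ℝ) → ℝ :=
  fun x => fderiv ℝ f x (Pi.single i 1)

/-- The classes `𝓛^{α,β}` of admissible differential operators of type `(α,β)`:
`𝓛^{1,0}` contains exactly the identity, and `L ∈ 𝓛^{α,β}` when there are distinct indices
`i_1,…,i_n` and operators `L_k ∈ 𝓛^{α_k,β_k}` with `α = Σ α_k`,
`β = Σ β_k + e_{i_1} + ⋯ + e_{i_n}` and `L F = det [∂_{x_{i_r}} (L_k F)]` for all smooth `F`. -/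
inductive IsAdmissible (d : ℕ) :
    ℕ → (Fin d → ℕ) → (((Fin d → ℝ) → ℝ) → (Fin d → ℝ) → ℝ) → Prop
  | id : IsAdmissible d 1 0 (fun F => F)
  | det (n : ℕ) (hn : 1 ≤ n) (hnd : n ≤ d) (i : Fin n → Fin d)
      (hi : Function.Injective i) (αs : Fin n → ℕ) (βs : Fin n → Fin d → ℕ)
      (Ls : Fin n → ((Fin d → ℝ) → ℝ) → (Fin d → ℝ) → ℝ)
      (hLs : ∀ k, IsAdmissible d (αs k) (βs k) (Ls k))
      (L : ((Fin d → ℝ) → ℝ) → (Fin d → ℝ) → ℝ)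
      (hL : ∀ F : (Fin d → ℝ) → ℝ, ∀ x, ContDiffAt ℝ (⊤ : ℕ∞) F x →
        L F x = (Matrix.of fun r k : Fin n => pderiv' (i r) (Ls k F) x).det) :
      IsAdmissible d (∑ k, αs k) ((∑ k, βs k) + ∑ k, Pi.single (i k) 1) L

/-- A `d`-tree on `m` indices: an element of `⋃ K, 𝒢_K` where `𝒢_0 = {1,…,m}` and
`𝒢_K = 𝒢_{K-1} ∪ (𝒢_{K-1})^d`. -/
inductive DTree (d m : ℕ) : Type
  | leaf : Fin m → DTree d m
  | node : (Fin d → DTree d m) → DTree d m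

namespace DTree
variable {d m : ℕ}

/-- `#G`: `0` for a trivial tree, `#G_1 + ⋯ + #G_d + 1` for `G = (G_1,…,G_d)`. -/
noncomputable def count : DTree d m → ℕ :=
  DTree.rec (motive := fun _ => ℕ) (fun _ => 0) (fun _ ih => (∑ k, ih k) + 1)

/-- `G^{(j)}`: the number of leaves of `G` carrying the index `j`. -/
noncomputable def mult (j : Fin m) : DTree d m → ℕ :=
  DTree.rec (motive := fun _ => ℕ) (fun i => if i = j then 1 else 0) (fun _ ih => ∑ k, ih k)

/-- The depth of a `d`-tree; `G ∈ 𝒢_K` if and only if `G.depth ≤ K`. -/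
noncomputable def depth : DTree d m → ℕ :=
  DTree.rec (motive := fun _ => ℕ) (fun _ => 0) (fun _ ih => (Finset.univ.sup ih) + 1)

/-- The derived function `∂^G π`: `π_i` for the trivial tree `i`, and the Jacobian
determinant `det [∂_{x_r} (∂^{G_k} π)]` for `G = (G_1,…,G_d)`. -/
noncomputable def deriv (π : Fin m → (Fin d → ℝ) → ℝ) : DTree d m → (Fin d → ℝ) → ℝ :=
  DTree.rec (motive := fun _ => (Fin d → ℝ) → ℝ) (fun i => π i)
    (fun _ ih x => (Matrix.of fun r k : Fin d => fderiv ℝ (ih k) x (Pi.single r 1)).det)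

/-- A `d`-tree is nontrivial when it is not a single leaf. -/
def Nontrivial (G : DTree d m) : Prop := ∀ i, G ≠ DTree.leaf i

end DTree

/-- If the columns of `M` indexed by the `inr` part of an equivalence are standard basis vectors,
then `det M` is the principal minor on the `inl` part. -/
theorem Matrix.det_eq_det_submatrix_of_col_eq_single {m n p R : Type*} [Fintype m] [Fintype n]
    [Fintype p] [DecidableEq m] [DecidableEq n] [DecidableEq p] [CommRing R] (e : n ⊕ p ≃ m)
    (M : Matrix m m R)
    (hM : ∀ r t, M r (e (Sum.inr t)) = (Pi.single r 1 : m → R) (e (Sum.inr t))) :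
    M.det = (M.submatrix (e ∘ Sum.inl) (e ∘ Sum.inl)).det := by
  have h : M.submatrix e e = Matrix.fromBlocks (M.submatrix (e ∘ Sum.inl) (e ∘ Sum.inl)) 0
      (M.submatrix (e ∘ Sum.inr) (e ∘ Sum.inl)) 1 := by
    ext (a | a) (b | b)
    · rfl
    · simp [hM]
    · rfl
    · simp [hM, Pi.single_apply, Matrix.one_apply, eq_comm]
  rw [← Matrix.det_submatrix_equiv_self e M, h, Matrix.det_fromBlocks_zero₁₂, Matrix.det_one,
    mul_one]

/-- The domain of an injection together with the complement of its range is equivalent to the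
codomain. -/
noncomputable def Function.Injective.sumComplRangeEquiv {ι κ : Type*} {i : ι → κ}
    (hi : Function.Injective i) : ι ⊕ ↥(Set.range i)ᶜ ≃ κ := by
  classical
  exact ((Equiv.ofInjective i hi).sumCongr (Equiv.refl _)).trans (Equiv.Set.sumCompl (Set.range i))

theorem Function.Injective.sumComplRangeEquiv_inl {ι κ : Type*} {i : ι → κ}
    (hi : Function.Injective i) (k : ι) : hi.sumComplRangeEquiv (Sum.inl k) = i k := by
  simp [Function.Injective.sumComplRangeEquiv]

namespace DTree
variable {d m : ℕ}

theorem deriv_node (π : Fin m → (Fin d → ℝ) → ℝ) (c : Fin d → DTree d m) (x : Fin d → ℝ) :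
    (node c).deriv π x =
      (Matrix.of fun r k : Fin d => fderiv ℝ ((c k).deriv π) x (Pi.single r 1)).det := rfl

theorem deriv_leaf (π : Fin m → (Fin d → ℝ) → ℝ) (j : Fin m) : (leaf j).deriv π = π j := rfl

theorem count_leaf (j : Fin m) : (leaf j : DTree d m).count = 0 := rfl

theorem count_node (c : Fin d → DTree d m) : (node c).count = ∑ k, (c k).count + 1 := rfl

theorem mult_leaf (j k : Fin m) : (leaf k : DTree d m).mult j = if k = j then 1 else 0 := rfl

theorem mult_node (j : Fin m) (c : Fin d → DTree d m) :
    (node c).mult j = ∑ k, (c k).mult j := rfl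

end DTree

/-- The subtraction-free form of the realization of admissible operators by trees, which also
covers the identity operator. -/
theorem IsAdmissible.exists_dtree
    {d : ℕ} {U : Set (Fin d → ℝ)} (hUopen : IsOpen U)
    {F : (Fin d → ℝ) → ℝ} (hF : ContDiffOn ℝ (⊤ : ℕ∞) F U)
    {π : Fin (d + 1) → (Fin d → ℝ) → ℝ}
    (hπcoord : ∀ i : Fin d, π i.castSucc = fun x => x i)
    (hπF : π (Fin.last d) = F)
    {α : ℕ} {β : Fin d → ℕ} {L : ((Fin d → ℝ) → ℝ) → (Fin d → ℝ) → ℝ}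
    (hL : IsAdmissible d α β L) :
    ∃ (G : DTree d (d + 1)) (ε : ℤˣ),
      (∀ x ∈ U, G.deriv π x = ((ε : ℤ) : ℝ) * L F x) ∧
      G.count + α = (∑ i, β i) + 1 ∧
      G.mult (Fin.last d) = α ∧
      ∀ i : Fin d, G.mult i.castSucc + β i = G.count := by
  induction hL with
  | id => exact ⟨.leaf (Fin.last d), 1, by simp [DTree.deriv_leaf, hπF], by simp [DTree.count_leaf],
      by simp [DTree.mult_leaf],
      by simp [DTree.mult_leaf, DTree.count_leaf, Fin.ext_iff, (Fin.is_lt _).ne']⟩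
  | det n hn hnd i hi αs βs Ls hLs L hL ih =>
    classical
    choose G ε hderiv hcount hlast hmult using ih
    let e := hi.sumComplRangeEquiv
    have he (k : Fin n) : e (Sum.inl k) = i k := hi.sumComplRangeEquiv_inl k
    let c : Fin d → DTree d (d + 1) := fun j =>
      Sum.elim G (fun t => .leaf (e (Sum.inr t)).castSucc) (e.symm j)
    have hcl (k : Fin n) : c (e (Sum.inl k)) = G k := by simp [c]
    have hcr (t) : c (e (Sum.inr t)) = .leaf (e (Sum.inr t)).castSucc := by simp [c]
    have hc : (DTree.node c).count = ∑ k, (G k).count + 1 := by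
      rw [DTree.count_node, ← e.sum_comp, Fintype.sum_sum_type]
      simp [hcl, hcr, DTree.count_leaf]
    refine ⟨.node c, ∏ k, ε k, fun x hx => ?_, ?_, ?_, fun j => ?_⟩
    · have hfd (k : Fin n) (v : Fin d → ℝ) : fderiv ℝ ((G k).deriv π) x v =
          ((ε k : ℤ) : ℝ) * fderiv ℝ (Ls k F) x v := by
        have h : (G k).deriv π =ᶠ[nhds x] ((ε k : ℤ) : ℝ) • Ls k F := by
          filter_upwards [hUopen.mem_nhds hx] with y hy using hderiv k y hy
        rw [h.fderiv_eq]
        rcases Int.units_eq_one_or (ε k) with h | h <;> simp [h, fderiv_neg]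
      rw [DTree.deriv_node, Matrix.det_eq_det_submatrix_of_col_eq_single e,
        hL F x (hF.contDiffAt (hUopen.mem_nhds hx))]
      · push_cast
        rw [← Matrix.det_mul_row]
        congr 1
        ext r k
        simp only [Matrix.submatrix_apply, Matrix.of_apply, Function.comp_apply, hcl, hfd, pderiv']
        rw [he]
      · intro r t
        simp only [Matrix.of_apply, hcr, DTree.deriv_leaf, hπcoord]
        rw [(hasFDerivAt_apply (𝕜 := ℝ) (e (Sum.inr t)) x).fderiv]
        rfl
    · have h1 := Finset.sum_congr rfl fun k (_ : k ∈ Finset.univ) => hcount k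
      have h2 : ∑ j, ((∑ k, βs k) + ∑ k, Pi.single (i k) 1 : Fin d → ℕ) j =
          (∑ k, ∑ j, βs k j) + n := by
        simp only [Pi.add_apply, Finset.sum_apply, Finset.sum_add_distrib]
        rw [Finset.sum_comm, Finset.sum_comm (f := fun j k => (Pi.single (i k) 1 : Fin d → ℕ) j)]
        simp
      simp only [Finset.sum_add_distrib, Finset.sum_const, Finset.card_univ, Fintype.card_fin,
        smul_eq_mul, mul_one] at h1
      lia
    · rw [DTree.mult_node, ← e.sum_comp, Fintype.sum_sum_type]
      simp [hcl, hcr, DTree.mult_leaf, hlast]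
    · have h1 := Finset.sum_congr rfl fun k (_ : k ∈ Finset.univ) => hmult k j
      have h2 : (∑ k, (Pi.single (i k) 1 : Fin d → ℕ) j) +
          ∑ t, (if e (Sum.inr t) = j then 1 else 0) = 1 := by
        have h : ∑ l, (if l = j then 1 else 0) = 1 := by simp
        rw [← e.sum_comp, Fintype.sum_sum_type] at h
        simpa [he, Pi.single_apply, eq_comm] using h
      rw [hc, DTree.mult_node, ← e.sum_comp, Fintype.sum_sum_type]
      simp only [hcl, hcr, DTree.mult_leaf, Fin.castSucc_inj, Pi.add_apply, Finset.sum_apply]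
      simp only [Finset.sum_add_distrib] at h1
      lia

/-- Every admissible operator of type `(α,β)` applied to `F` is realized (up to sign) by a
`d`-tree on `d+1` indices for the functions `π_i = x_i` (`i = 1,…,d`), `π_{d+1} = F`, with
`#G = |β|+1-α`, `G^{(d+1)} = α` and `G^{(i)} = |β|+1-α-β_i`. -/
theorem admissible_realized_by_dtree
    (d : ℕ) (U : Set (Fin d → ℝ)) (hUopen : IsOpen U)
    (F : (Fin d → ℝ) → ℝ) (hF : ContDiffOn ℝ (⊤ : ℕ∞) F U)
    (π : Fin (d + 1) → (Fin d → ℝ) → ℝ)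
    (hπcoord : ∀ i : Fin d, π i.castSucc = fun x => x i)
    (hπF : π (Fin.last d) = F)
    (α : ℕ) (β : Fin d → ℕ) (L : ((Fin d → ℝ) → ℝ) → (Fin d → ℝ) → ℝ)
    (hL : IsAdmissible d α β L) (hne : ¬(α = 1 ∧ β = 0)) :
    ∃ G : DTree d (d + 1),
      ((∀ x ∈ U, G.deriv π x = L F x) ∨ (∀ x ∈ U, G.deriv π x = -(L F x))) ∧
      G.count = (∑ i, β i) + 1 - α ∧
      G.mult (Fin.last d) = α ∧
      (∀ i : Fin d, G.mult i.castSucc = (∑ i, β i) + 1 - α - β i) ∧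
      ∀ i : Fin d, β i ≤ (∑ i, β i) + 1 - α := by
  obtain ⟨G, ε, hderiv, hcount, hlast, hmult⟩ := hL.exists_dtree hUopen hF hπcoord hπF
  refine ⟨G, ?_, by lia, hlast, fun i => ?_, fun i => ?_⟩
  · rcases Int.units_eq_one_or ε with h | h
    · exact .inl fun x hx => by simp [hderiv x hx, h]
    · exact .inr fun x hx => by simp [hderiv x hx, h]
  · have := hmult i
    lia
  · have := hmult i
    lia
end

section
/- Let d ≥ 2, let F be smooth on an open set U ⊆ ℝ^d, and set π_i(x) = x_i for i = 1,…,d and π_{d+1} = F. For k = 1,…,d let H_k be the d-tree in 𝒢_1 on d+1 indices given by the d-tuple (1,…,k−1, d+1, k+1,…,d) (i.e. (1,…,d) with the k-th entry replaced by d+1), and let G' := (H_1,…,H_d). Then: (i) ∂^{H_k}π = ∂F/∂x_k for each k; (ii) ∂^{G'}π = det(Hess F), the determinant of the Hessian matrix [∂²F/∂x_r∂x_k]_{r,k=1}^d; (iii) #G' = d+1, G'^{(i)} = d−1 for i = 1,…,d, and G'^{(d+1)} = d. -/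
open MeasureTheory
open scoped ENNReal

/-- The `d`-tree `H_k = (1,…,k-1,d+1,k+1,…,d)`: the tuple `(1,…,d)` with the `k`-th entry
replaced by `d+1`. -/
noncomputable def hessRow (d : ℕ) (k : Fin d) : DTree d (d + 1) :=
  DTree.node fun r : Fin d =>
    DTree.leaf (if r = k then Fin.last d else (r.castSucc : Fin (d + 1)))

/-- The `d`-tree `G' = (H_1,…,H_d)` computing the Hessian determinant. -/
noncomputable def hessTree (d : ℕ) : DTree d (d + 1) :=
  DTree.node (hessRow d)

theorem hessRow_deriv {d : ℕ} {F : (Fin d → ℝ) → ℝ} {π : Fin (d + 1) → (Fin d → ℝ) → ℝ}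
    (hπcoord : ∀ i : Fin d, π i.castSucc = fun x => x i) (hπF : π (Fin.last d) = F)
    (k : Fin d) : (hessRow d k).deriv π = fun x => fderiv ℝ F x (Pi.single k 1) := by
  funext x
  change (Matrix.of fun r j : Fin d => fderiv ℝ
    (π (if j = k then Fin.last d else (j.castSucc : Fin (d + 1)))) x (Pi.single r 1)).det = _
  rw [show (Matrix.of fun r j : Fin d => fderiv ℝ
      (π (if j = k then Fin.last d else (j.castSucc : Fin (d + 1)))) x (Pi.single r 1)) =
      (1 : Matrix (Fin d) (Fin d) ℝ).updateCol k fun r => fderiv ℝ F x (Pi.single r 1) from ?_]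
  · rw [← Matrix.cramer_apply, Matrix.cramer_one]
    rfl
  · ext r j
    by_cases h : j = k
    · simp [h, hπF]
    · simp [h, hπcoord, (hasFDerivAt_apply (𝕜 := ℝ) j x).fderiv, Matrix.one_apply,
        Pi.single_apply, eq_comm (a := r)]

theorem hessRow_mult {d : ℕ} (k : Fin d) (j : Fin (d + 1)) :
    (hessRow d k).mult j =
      ∑ r : Fin d, if (if r = k then Fin.last d else r.castSucc) = j then 1 else 0 := rfl

theorem hessTree_count (d : ℕ) : (hessTree d).count = d + 1 := by
  change (∑ _k : Fin d, ((∑ _r : Fin d, 0) + 1)) + 1 = d + 1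
  simp

theorem hessTree_mult (d : ℕ) (j : Fin (d + 1)) :
    (hessTree d).mult j = ∑ k : Fin d, (hessRow d k).mult j := rfl

theorem hessRow_mult_castSucc {d : ℕ} (k i : Fin d) :
    (hessRow d k).mult i.castSucc = if k = i then 0 else 1 := by
  rw [hessRow_mult, Finset.sum_eq_single i]
  · by_cases h : k = i
    · simp [h, (Fin.castSucc_lt_last i).ne']
    · simp [h, Ne.symm h]
  · intro r _ hr
    by_cases h : r = k <;> simp_all [(Fin.castSucc_lt_last i).ne']
  · simp

theorem hessRow_mult_last {d : ℕ} (k : Fin d) : (hessRow d k).mult (Fin.last d) = 1 := by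
  rw [hessRow_mult, Finset.sum_eq_single k]
  · simp
  · intro r _ hr
    simp [hr, (Fin.castSucc_lt_last r).ne]
  · simp

/-- The Hessian example: with `π_i = x_i` (`i = 1,…,d`) and `π_{d+1} = F`, one has
`∂^{H_k}π = ∂F/∂x_k`, `∂^{G'}π = det Hess F`, `#G' = d+1`, `G'^{(i)} = d-1` for `i ≤ d`,
and `G'^{(d+1)} = d`. -/
theorem hessian_dtree_example
    (d : ℕ) (hd : 2 ≤ d) (U : Set (Fin d → ℝ)) (hUopen : IsOpen U)
    (F : (Fin d → ℝ) → ℝ) (hF : ContDiffOn ℝ (⊤ : ℕ∞) F U)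
    (π : Fin (d + 1) → (Fin d → ℝ) → ℝ)
    (hπcoord : ∀ i : Fin d, π i.castSucc = fun x => x i)
    (hπF : π (Fin.last d) = F) :
    (∀ k : Fin d, ∀ x ∈ U, (hessRow d k).deriv π x = fderiv ℝ F x (Pi.single k 1)) ∧
    (∀ x ∈ U, (hessTree d).deriv π x =
      (Matrix.of fun r k : Fin d =>
        fderiv ℝ (fun y => fderiv ℝ F y (Pi.single k 1)) x (Pi.single r 1)).det) ∧
    (hessTree d).count = d + 1 ∧
    (∀ i : Fin d, (hessTree d).mult i.castSucc = d - 1) ∧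
    (hessTree d).mult (Fin.last d) = d := by
  refine ⟨fun k x _ => congrFun (hessRow_deriv hπcoord hπF k) x, fun x _ => ?_,
    hessTree_count d, fun i => ?_, ?_⟩
  · change (Matrix.of fun r k : Fin d =>
      fderiv ℝ ((hessRow d k).deriv π) x (Pi.single r 1)).det = _
    simp only [hessRow_deriv hπcoord hπF]
  · simp [hessTree_mult, hessRow_mult_castSucc, Finset.sum_ite, Finset.filter_ne']
  · simp [hessTree_mult, hessRow_mult_last]
end

section
/- Let p : ℝ → ℝ be smooth and let ℓ : ℝ^d → ℝ be linear. Then for every admissible differential operator L of type (α,β) with α ≥ 2, the function L(p∘ℓ) vanishes identically on ℝ^d. -/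
open MeasureTheory
open scoped ENNReal

/-- The chain rule for the partial derivatives of `q ∘ ℓ` with `ℓ` linear. -/
theorem pderiv'_comp_linear {d : ℕ} (i : Fin d) {q : ℝ → ℝ} (hq : Differentiable ℝ q)
    (ℓ : (Fin d → ℝ) →ₗ[ℝ] ℝ) (x : Fin d → ℝ) :
    pderiv' i (fun y => q (ℓ y)) x = ℓ (Pi.single i 1) * deriv q (ℓ x) := by
  have hℓ : HasFDerivAt (fun y => ℓ y) (LinearMap.toContinuousLinearMap ℓ) x :=
    (LinearMap.toContinuousLinearMap ℓ).hasFDerivAt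
  have h := (hq (ℓ x)).hasDerivAt.comp_hasFDerivAt x hℓ
  rw [pderiv', show fderiv ℝ (fun y => q (ℓ y)) x = _ from h.fderiv]
  simp [mul_comm]

/-- An admissible operator maps a smooth function of `ℓ` to a smooth function of `ℓ`, and to zero
when `α ≥ 2`. -/
theorem IsAdmissible.exists_comp_linear {d α : ℕ} {β : Fin d → ℕ}
    {L : ((Fin d → ℝ) → ℝ) → (Fin d → ℝ) → ℝ} (hL : IsAdmissible d α β L)
    {p : ℝ → ℝ} (hp : ContDiff ℝ (⊤ : ℕ∞) p) (ℓ : (Fin d → ℝ) →ₗ[ℝ] ℝ) :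
    ∃ q : ℝ → ℝ, ContDiff ℝ (⊤ : ℕ∞) q ∧ L (fun y => p (ℓ y)) = (fun y => q (ℓ y)) ∧
      (2 ≤ α → q = 0) := by
  induction hL with
  | id => exact ⟨p, hp, rfl, fun h => absurd h (by norm_num)⟩
  | det n hn _ i _ αs _ Ls _ L hL ih =>
    choose q hq hLq hq0 using ih
    have hF : ContDiff ℝ (⊤ : ℕ∞) (fun y => p (ℓ y)) :=
      hp.comp (LinearMap.toContinuousLinearMap ℓ).contDiff
    have key (x) : L (fun y => p (ℓ y)) x =
        (Matrix.vecMulVec (fun r => ℓ (Pi.single (i r) 1)) (fun k => deriv (q k) (ℓ x))).det := by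
      rw [hL _ x hF.contDiffAt]
      congr 1
      ext r k
      rw [Matrix.of_apply, hLq, pderiv'_comp_linear _ ((hq k).differentiable (by simp))]
      rfl
    obtain rfl | hn2 := hn.eq_or_lt
    · refine ⟨fun t => ℓ (Pi.single (i 0) 1) * deriv (q 0) t, ?_, ?_, ?_⟩
      · exact contDiff_const.mul (contDiff_infty_iff_deriv.1 (hq 0)).2
      · ext x
        simp [key, Matrix.vecMulVec_apply]
      · intro h
        ext t
        simp [hq0 0 (by simpa using h)]
    · have : Nontrivial (Fin n) := Fin.nontrivial_iff_two_le.2 hn2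
      refine ⟨0, contDiff_const, ?_, fun _ => rfl⟩
      ext x
      simp [key, Matrix.det_vecMulVec]

/-- Degeneracy of compositions with linear maps: if `p : ℝ → ℝ` is smooth and
`ℓ : ℝ^d → ℝ` is linear, then `L(p ∘ ℓ) ≡ 0` for every admissible operator of type
`(α,β)` with `α ≥ 2`. -/
theorem admissible_vanishes_on_linear_composition
    (d : ℕ) (α : ℕ) (β : Fin d → ℕ) (L : ((Fin d → ℝ) → ℝ) → (Fin d → ℝ) → ℝ)
    (hL : IsAdmissible d α β L) (hα : 2 ≤ α)
    (p : ℝ → ℝ) (hp : ContDiff ℝ (⊤ : ℕ∞) p) (ℓ : (Fin d → ℝ) →ₗ[ℝ] ℝ) :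
    ∀ x, L (fun y => p (ℓ y)) x = 0 := by
  obtain ⟨q, -, hLq, hq⟩ := hL.exists_comp_linear hp ℓ
  simp [hLq, hq hα]
end

section
/- For each positive integer N define F_N : ℝ² → ℝ by F_N(x,y) = N^{−1} e^x sin(Ny). Then: (i) the determinant of the Hessian matrix of F_N equals −e^{2x} at every point (x,y), so in particular |det Hess F_N(x,y)| ≥ 1 for all (x,y) ∈ [0,1]²; (ii) for every ε > 0 and every integer N with N ≥ e/ε, one has {(x,y) ∈ [0,1]² : |F_N(x,y)| ≤ ε} = [0,1]²; consequently (iii) for every C > 0 and every ρ > 0 there exist a positive integer N and ε > 0 such that the Lebesgue measure of {(x,y) ∈ [0,1]² : |F_N(x,y)| ≤ ε} is strictly greater than C·ε^ρ. Hence no uniform sublevel-set bound of the form |{|F| ≤ ε} ∩ [0,1]²| ≤ C ε^ρ can hold over all smooth F with |det Hess F| ≥ 1 on [0,1]². -/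
open MeasureTheory
open scoped ENNReal

/-- The family `F_N(x,y) = N⁻¹ e^x sin (N y)`. -/
noncomputable def FN (N : ℕ) : ℝ × ℝ → ℝ :=
  fun q => (N : ℝ)⁻¹ * Real.exp q.1 * Real.sin (N * q.2)

/-- The determinant of the `2×2` Hessian matrix of `F : ℝ² → ℝ`. -/
noncomputable def detHess2 (F : ℝ × ℝ → ℝ) (q : ℝ × ℝ) : ℝ :=
  fderiv ℝ (fun w => fderiv ℝ F w ((1 : ℝ), (0 : ℝ))) q ((1 : ℝ), (0 : ℝ)) *
      fderiv ℝ (fun w => fderiv ℝ F w ((0 : ℝ), (1 : ℝ))) q ((0 : ℝ), (1 : ℝ)) -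
    fderiv ℝ (fun w => fderiv ℝ F w ((0 : ℝ), (1 : ℝ))) q ((1 : ℝ), (0 : ℝ)) *
      fderiv ℝ (fun w => fderiv ℝ F w ((1 : ℝ), (0 : ℝ))) q ((0 : ℝ), (1 : ℝ))

theorem fderiv_exp_fst_mul_snd_apply {f : ℝ → ℝ} {f' : ℝ} {q : ℝ × ℝ}
    (hf : HasDerivAt f f' q.2) (v : ℝ × ℝ) :
    fderiv ℝ (fun w : ℝ × ℝ => Real.exp w.1 * f w.2) q v =
      Real.exp q.1 * (v.1 * f q.2 + v.2 * f') := by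
  have h₁ : HasFDerivAt (fun w : ℝ × ℝ => Real.exp w.1)
      (Real.exp q.1 • ContinuousLinearMap.fst ℝ ℝ ℝ) q := hasFDerivAt_fst.exp
  have h₂ : HasFDerivAt (fun w : ℝ × ℝ => f w.2) (f' • ContinuousLinearMap.snd ℝ ℝ ℝ) q :=
    hf.comp_hasFDerivAt q hasFDerivAt_snd
  rw [(h₁.fun_mul h₂).fderiv]
  simp only [add_apply, smul_apply,
    ContinuousLinearMap.coe_fst', ContinuousLinearMap.coe_snd', smul_eq_mul]
  ring

/-- The Hessian determinant of a function of the form `e^x f(y)`. -/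
theorem detHess2_exp_fst_mul_snd {f f' f'' : ℝ → ℝ} (hf : ∀ y, HasDerivAt f (f' y) y)
    (hf' : ∀ y, HasDerivAt f' (f'' y) y) (q : ℝ × ℝ) :
    detHess2 (fun w => Real.exp w.1 * f w.2) q =
      Real.exp (2 * q.1) * (f q.2 * f'' q.2 - f' q.2 ^ 2) := by
  simp only [detHess2, fderiv_exp_fst_mul_snd_apply (hf _), fderiv_exp_fst_mul_snd_apply (hf' _),
    one_mul, zero_mul, add_zero, zero_add]
  rw [two_mul, Real.exp_add]
  ring

theorem detHess2_FN {N : ℕ} (hN : 0 < N) (q : ℝ × ℝ) :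
    detHess2 (FN N) q = -Real.exp (2 * q.1) := by
  have hN' : (N : ℝ) ≠ 0 := by positivity
  have hlin (y : ℝ) : HasDerivAt (fun t : ℝ => (N : ℝ) * t) N y := by
    simpa using (hasDerivAt_id y).const_mul (N : ℝ)
  have hsin (y : ℝ) :
      HasDerivAt (fun t : ℝ => (N : ℝ)⁻¹ * Real.sin (N * t)) (Real.cos (N * y)) y :=
    ((hlin y).sin.const_mul (N : ℝ)⁻¹).congr_deriv (by field_simp)
  have hcos (y : ℝ) :
      HasDerivAt (fun t : ℝ => Real.cos (N * t)) (-Real.sin (N * y) * N) y := (hlin y).cos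
  have hFN : FN N = fun w => Real.exp w.1 * ((N : ℝ)⁻¹ * Real.sin (N * w.2)) := by
    funext w
    simp only [FN]
    ring
  rw [hFN, detHess2_exp_fst_mul_snd hsin hcos]
  have hcancel : (N : ℝ)⁻¹ * N = 1 := inv_mul_cancel₀ hN'
  linear_combination (-Real.exp (2 * q.1) * Real.sin (N * q.2) ^ 2) * hcancel -
    Real.exp (2 * q.1) * Real.sin_sq_add_cos_sq (N * q.2)

theorem one_le_abs_detHess2_FN {N : ℕ} (hN : 0 < N) {q : ℝ × ℝ} (hq : 0 ≤ q.1) :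
    1 ≤ |detHess2 (FN N) q| := by
  rw [detHess2_FN hN, abs_neg, Real.abs_exp]
  exact Real.one_le_exp (by positivity)

theorem abs_FN_le (N : ℕ) {q : ℝ × ℝ} (hq : q.1 ≤ 1) : |FN N q| ≤ (N : ℝ)⁻¹ * Real.exp 1 := by
  rw [FN, abs_mul, abs_mul, Real.abs_exp, abs_of_nonneg (by positivity : (0 : ℝ) ≤ (N : ℝ)⁻¹)]
  calc (N : ℝ)⁻¹ * Real.exp q.1 * |Real.sin (N * q.2)|
      ≤ (N : ℝ)⁻¹ * Real.exp q.1 * 1 := by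
        gcongr
        exact Real.abs_sin_le_one _
    _ ≤ (N : ℝ)⁻¹ * Real.exp 1 := by
        rw [mul_one]
        gcongr

theorem sublevel_FN_eq {ε : ℝ} (hε : 0 < ε) {N : ℕ} (hN : 0 < N) (h : Real.exp 1 / ε ≤ N) :
    {q ∈ Set.Icc (0 : ℝ) 1 ×ˢ Set.Icc (0 : ℝ) 1 | |FN N q| ≤ ε} =
      Set.Icc (0 : ℝ) 1 ×ˢ Set.Icc (0 : ℝ) 1 := by
  have hN' : (0 : ℝ) < N := by exact_mod_cast hN
  refine Set.sep_eq_self_iff_mem_true.2 fun q hq => (abs_FN_le N hq.1.2).trans ?_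
  rw [inv_mul_le_iff₀ hN']
  exact (div_le_iff₀ hε).1 h

theorem volume_unitSquare :
    volume (Set.Icc (0 : ℝ) 1 ×ˢ Set.Icc (0 : ℝ) 1) = 1 := by
  rw [Measure.volume_eq_prod, Measure.prod_prod, Real.volume_Icc]
  simp

theorem contDiff_FN (N : ℕ) {n : WithTop ℕ∞} : ContDiff ℝ n (FN N) := by
  unfold FN
  fun_prop

theorem exists_mul_rpow_lt_volume_sublevel_FN {C : ℝ} (hC : 0 < C) {ρ : ℝ} (hρ : 0 < ρ) :
    ∃ N : ℕ, 0 < N ∧ ∃ ε : ℝ, 0 < ε ∧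
      C * ε ^ ρ <
        (volume {q ∈ Set.Icc (0 : ℝ) 1 ×ˢ Set.Icc (0 : ℝ) 1 | |FN N q| ≤ ε}).toReal := by
  set ε : ℝ := ((2 * C)⁻¹) ^ ρ⁻¹
  have hε : 0 < ε := by positivity
  have hN : 0 < ⌈Real.exp 1 / ε⌉₊ := Nat.ceil_pos.2 (by positivity)
  refine ⟨⌈Real.exp 1 / ε⌉₊, hN, ε, hε, ?_⟩
  rw [sublevel_FN_eq hε hN (Nat.le_ceil _), volume_unitSquare, ENNReal.toReal_one,
    Real.rpow_inv_rpow (by positivity) hρ.ne']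
  field_simp
  norm_num

/-- The counterexample `F_N(x,y) = N⁻¹ e^x sin(Ny)`: the Hessian determinant is `-e^{2x}`
(so `|det Hess F_N| ≥ 1` on the unit square), yet for `N ≥ e/ε` the `ε`-sublevel set of
`F_N` is the whole square; hence no uniform sublevel bound `|{|F| ≤ ε}| ≤ C ε^ρ` can hold
over all smooth `F` with `|det Hess F| ≥ 1` on the square. -/
theorem FN_hessian_counterexample :
    (∀ N : ℕ, 0 < N → ∀ q : ℝ × ℝ, detHess2 (FN N) q = -Real.exp (2 * q.1)) ∧
    (∀ N : ℕ, 0 < N → ∀ q ∈ Set.Icc (0 : ℝ) 1 ×ˢ Set.Icc (0 : ℝ) 1,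
      1 ≤ |detHess2 (FN N) q|) ∧
    (∀ ε : ℝ, 0 < ε → ∀ N : ℕ, 0 < N → Real.exp 1 / ε ≤ N →
      {q ∈ Set.Icc (0 : ℝ) 1 ×ˢ Set.Icc (0 : ℝ) 1 | |FN N q| ≤ ε} =
        Set.Icc (0 : ℝ) 1 ×ˢ Set.Icc (0 : ℝ) 1) ∧
    (∀ C : ℝ, 0 < C → ∀ ρ : ℝ, 0 < ρ → ∃ N : ℕ, 0 < N ∧ ∃ ε : ℝ, 0 < ε ∧
      C * ε ^ ρ <
        (volume {q ∈ Set.Icc (0 : ℝ) 1 ×ˢ Set.Icc (0 : ℝ) 1 | |FN N q| ≤ ε}).toReal) ∧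
    (∀ C : ℝ, 0 < C → ∀ ρ : ℝ, 0 < ρ →
      ¬ ∀ F : ℝ × ℝ → ℝ, ContDiff ℝ (⊤ : ℕ∞) F →
        (∀ q ∈ Set.Icc (0 : ℝ) 1 ×ˢ Set.Icc (0 : ℝ) 1, 1 ≤ |detHess2 F q|) →
        ∀ ε : ℝ, 0 < ε →
          (volume {q ∈ Set.Icc (0 : ℝ) 1 ×ˢ Set.Icc (0 : ℝ) 1 | |F q| ≤ ε}).toReal ≤
            C * ε ^ ρ) := by
  refine ⟨fun N hN q => detHess2_FN hN q, fun N hN q hq => one_le_abs_detHess2_FN hN hq.1.1,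
    fun ε hε N hN h => sublevel_FN_eq hε hN h,
    fun C hC ρ hρ => exists_mul_rpow_lt_volume_sublevel_FN hC hρ, fun C hC ρ hρ h => ?_⟩
  obtain ⟨N, hN, ε, hε, hlt⟩ := exists_mul_rpow_lt_volume_sublevel_FN hC hρ
  exact hlt.not_ge
    (h (FN N) (contDiff_FN N) (fun q hq => one_le_abs_detHess2_FN hN hq.1.1) ε hε)
end

section
/- Let S ≥ 1 and let η_0 : ℝ → ℝ be a C¹ function with support contained in [−1,1], with η_0(t) = 1 for |t| ≤ 1/2, and with |η_0(t)| ≤ 1 for all t. For δ ∈ [0,∞)^S and s ∈ ℝ^S define, for each index σ ∈ {1,…,S}, ψ_σ(s) := (δ_σ² s_σ / Σ_{σ'} δ_{σ'}² s_{σ'}²)·(1 − Π_{σ'} η_0(δ_{σ'} s_{σ'})) when Σ_{σ'} δ_{σ'}² s_{σ'}² ≠ 0, and ψ_σ(s) := 0 otherwise. Then ψ_σ is C¹ on all of ℝ^S (it vanishes identically on a neighborhood of every point where Σ_{σ'} δ_{σ'}² s_{σ'}² = 0, since ψ_σ(s) = 0 whenever |δ_{σ'} s_{σ'}| ≤ 1/2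 for every σ'), and there exists a finite constant C, depending only on S and η_0 but not on δ or s, such that for all indices σ, σ' and all s ∈ ℝ^S: |ψ_σ(s)| ≤ C·δ_σ and |∂ψ_σ/∂s_{σ'}(s)| ≤ C·δ_σ·δ_{σ'}/(1 + δ_{σ'}² s_{σ'}²). -/
open MeasureTheory
open scoped ENNReal

/-- The damping functions
`ψ_σ(s) = (δ_σ² s_σ / Σ_{σ'} δ_{σ'}² s_{σ'}²)·(1 − Π_{σ'} η₀(δ_{σ'} s_{σ'}))`
(set to `0` where `Σ_{σ'} δ_{σ'}² s_{σ'}² = 0`). -/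
noncomputable def dampPsi {S : ℕ} (η₀ : ℝ → ℝ) (δ : Fin S → ℝ) (σ : Fin S)
    (s : Fin S → ℝ) : ℝ :=
  if (∑ σ', (δ σ') ^ 2 * (s σ') ^ 2) = 0 then 0
  else ((δ σ) ^ 2 * s σ / ∑ σ', (δ σ') ^ 2 * (s σ') ^ 2) *
    (1 - ∏ σ', η₀ (δ σ' * s σ'))

/-- The sum of squares of the coordinates controls every single coordinate. -/
theorem sq_le_sum_sq {S : ℕ} (x : Fin S → ℝ) (i : Fin S) : (x i) ^ 2 ≤ ∑ j, (x j) ^ 2 :=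
  Finset.single_le_sum (f := fun j => (x j) ^ 2) (fun j _ => sq_nonneg (x j)) (Finset.mem_univ i)

theorem dampPsi_one {S : ℕ} (η₀ : ℝ → ℝ) (σ : Fin S) (x : Fin S → ℝ) :
    dampPsi η₀ 1 σ x = x σ / (∑ i, (x i) ^ 2) * (1 - ∏ i, η₀ (x i)) := by
  unfold dampPsi
  split_ifs with h
  · have h' : ∑ i, (x i) ^ 2 = 0 := by simpa using h
    simp [h']
  · simp

/-- The general damping function is a rescaling of the one with unit weights. -/
theorem dampPsi_eq_mul_dampPsi_one {S : ℕ} (η₀ : ℝ → ℝ) (δ : Fin S → ℝ) (σ : Fin S) :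
    dampPsi η₀ δ σ = fun s => δ σ * dampPsi η₀ 1 σ (fun i => δ i * s i) := by
  funext s
  rw [dampPsi_one]
  unfold dampPsi
  simp only [mul_pow]
  split_ifs with h
  · simp [h]
  · ring

theorem dampPsi_one_eq_zero {S : ℕ} {η₀ : ℝ → ℝ} (hone : ∀ t : ℝ, |t| ≤ 1 / 2 → η₀ t = 1)
    (σ : Fin S) {x : Fin S → ℝ} (hx : ∑ i, (x i) ^ 2 < 1 / 4) : dampPsi η₀ 1 σ x = 0 := by
  have h : ∏ i, η₀ (x i) = 1 := Finset.prod_eq_one fun i _ => hone _ <| by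
    have := sq_le_sum_sq x i
    exact abs_le_of_sq_le_sq (by linarith) (by norm_num)
  rw [dampPsi_one, h]
  simp

theorem dampPsi_one_eventuallyEq_zero {S : ℕ} {η₀ : ℝ → ℝ}
    (hone : ∀ t : ℝ, |t| ≤ 1 / 2 → η₀ t = 1) (σ : Fin S) {x : Fin S → ℝ}
    (hx : ∑ i, (x i) ^ 2 < 1 / 4) : dampPsi η₀ 1 σ =ᶠ[nhds x] fun _ => 0 := by
  have hc : Continuous fun y : Fin S → ℝ => ∑ i, (y i) ^ 2 := by fun_prop
  filter_upwards [hc.continuousAt.eventually_lt continuousAt_const hx] with y hy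
  exact dampPsi_one_eq_zero hone σ hy

theorem contDiff_dampPsi_one {S : ℕ} {η₀ : ℝ → ℝ} (hC1 : ContDiff ℝ 1 η₀)
    (hone : ∀ t : ℝ, |t| ≤ 1 / 2 → η₀ t = 1) (σ : Fin S) :
    ContDiff ℝ 1 (dampPsi η₀ 1 σ) := by
  rw [contDiff_iff_contDiffAt]
  intro x
  by_cases hx : ∑ i, (x i) ^ 2 < 1 / 4
  · exact contDiffAt_const.congr_of_eventuallyEq (dampPsi_one_eventuallyEq_zero hone σ hx)
  · have hR : ∑ i, (x i) ^ 2 ≠ 0 := by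
      intro h
      rw [h] at hx
      norm_num at hx
    rw [funext (dampPsi_one η₀ σ)]
    refine ContDiffAt.mul (ContDiffAt.div (by fun_prop) (ContDiff.contDiffAt ?_) hR)
      (contDiffAt_const.sub (ContDiff.contDiffAt ?_))
    · exact ContDiff.sum fun i _ => by fun_prop
    · exact contDiff_prod fun i _ => hC1.comp (contDiff_apply ℝ ℝ i)

theorem abs_prod_le_one {ι : Type*} {f : ι → ℝ} (s : Finset ι) (hf : ∀ i, |f i| ≤ 1) :
    |∏ i ∈ s, f i| ≤ 1 := by
  rw [Finset.abs_prod]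
  exact Finset.prod_le_one (fun i _ => abs_nonneg _) fun i _ => hf i

theorem abs_one_sub_le_two {p : ℝ} (hp : |p| ≤ 1) : |1 - p| ≤ 2 := by
  rw [abs_le] at *
  constructor <;> linarith

theorem abs_div_sum_sq_le_two {S : ℕ} (σ : Fin S) {x : Fin S → ℝ}
    (hx : 1 / 4 ≤ ∑ i, (x i) ^ 2) : |x σ / ∑ i, (x i) ^ 2| ≤ 2 := by
  have h := sq_le_sum_sq x σ
  have hR : 0 < ∑ i, (x i) ^ 2 := by linarith
  rw [abs_div, abs_of_pos hR, div_le_iff₀ hR]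
  rw [← sq_abs] at h
  nlinarith [sq_nonneg (|x σ| - 1 / 2), abs_nonneg (x σ)]

theorem abs_dampPsi_one_le {S : ℕ} {η₀ : ℝ → ℝ} (hone : ∀ t : ℝ, |t| ≤ 1 / 2 → η₀ t = 1)
    (hbd : ∀ t : ℝ, |η₀ t| ≤ 1) (σ : Fin S) (x : Fin S → ℝ) : |dampPsi η₀ 1 σ x| ≤ 4 := by
  by_cases hx : ∑ i, (x i) ^ 2 < 1 / 4
  · rw [dampPsi_one_eq_zero hone σ hx]
    norm_num
  · rw [dampPsi_one, abs_mul]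
    calc _ ≤ (2 : ℝ) * 2 := mul_le_mul (abs_div_sum_sq_le_two σ (not_lt.mp hx))
          (abs_one_sub_le_two (abs_prod_le_one _ fun i => hbd (x i))) (abs_nonneg _) (by norm_num)
      _ = 4 := by norm_num

/-- A `C¹` function supported in `[-1, 1]` has a derivative that is `O(1 / (1 + t²))`. -/
theorem exists_abs_deriv_le_div {η₀ : ℝ → ℝ} (hC1 : ContDiff ℝ 1 η₀)
    (hsupp : Function.support η₀ ⊆ Set.Icc (-1 : ℝ) 1) :
    ∃ M : ℝ, 0 ≤ M ∧ ∀ t, |deriv η₀ t| ≤ M / (1 + t ^ 2) := by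
  obtain ⟨K, hK⟩ := (isCompact_Icc (a := (-1 : ℝ)) (b := 1)).exists_bound_of_continuousOn
    (hC1.continuous_deriv le_rfl).continuousOn
  have hK0 : 0 ≤ K := (norm_nonneg _).trans (hK 0 (by norm_num))
  refine ⟨2 * K, by positivity, fun t => ?_⟩
  by_cases ht : t ∈ Set.Icc (-1 : ℝ) 1
  · rw [le_div_iff₀ (by positivity)]
    have h1 := hK t ht
    rw [Real.norm_eq_abs] at h1
    have h2 : t ^ 2 ≤ 1 := by nlinarith [ht.1, ht.2]
    nlinarith [abs_nonneg (deriv η₀ t)]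
  · have h0 : deriv η₀ t = 0 := by
      by_contra h
      exact ht (closure_minimal hsupp isClosed_Icc (support_deriv_subset h))
    rw [h0, abs_zero]
    positivity

theorem hasDerivAt_sum_sq_update {S : ℕ} (x : Fin S → ℝ) (τ : Fin S) :
    HasDerivAt (fun t => ∑ i, (Function.update x τ t i) ^ 2) (2 * x τ) (x τ) := by
  have h : (fun t => ∑ i, (Function.update x τ t i) ^ 2) =
      fun t => t ^ 2 + ∑ i ∈ Finset.univ.erase τ, (x i) ^ 2 := by
    funext t
    rw [← Finset.add_sum_erase _ _ (Finset.mem_univ τ), Function.update_self]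
    congr 1
    exact Finset.sum_congr rfl fun i hi => by
      rw [Function.update_of_ne (Finset.ne_of_mem_erase hi)]
  rw [h]
  simpa using (hasDerivAt_pow 2 (x τ)).add_const (∑ i ∈ Finset.univ.erase τ, (x i) ^ 2)

theorem hasDerivAt_prod_update {S : ℕ} {η₀ : ℝ → ℝ} (hη : Differentiable ℝ η₀)
    (x : Fin S → ℝ) (τ : Fin S) :
    HasDerivAt (fun t => ∏ i, η₀ (Function.update x τ t i))
      (deriv η₀ (x τ) * ∏ i ∈ Finset.univ.erase τ, η₀ (x i)) (x τ) := by
  have h : (fun t => ∏ i, η₀ (Function.update x τ t i)) =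
      fun t => η₀ t * ∏ i ∈ Finset.univ.erase τ, η₀ (x i) := by
    funext t
    rw [← Finset.mul_prod_erase _ _ (Finset.mem_univ τ), Function.update_self]
    congr 1
    exact Finset.prod_congr rfl fun i hi => by
      rw [Function.update_of_ne (Finset.ne_of_mem_erase hi)]
  rw [h]
  exact (hη (x τ)).hasDerivAt.mul_const _

theorem fderiv_dampPsi_one {S : ℕ} {η₀ : ℝ → ℝ} (hC1 : ContDiff ℝ 1 η₀)
    (hone : ∀ t : ℝ, |t| ≤ 1 / 2 → η₀ t = 1) (σ τ : Fin S) {x : Fin S → ℝ}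
    (hx : ∑ i, (x i) ^ 2 ≠ 0) :
    fderiv ℝ (dampPsi η₀ 1 σ) x (Pi.single τ 1) =
      ((Pi.single τ 1 : Fin S → ℝ) σ * (∑ i, (x i) ^ 2) - x σ * (2 * x τ)) /
          (∑ i, (x i) ^ 2) ^ 2 * (1 - ∏ i, η₀ (x i)) -
        x σ / (∑ i, (x i) ^ 2) *
          (deriv η₀ (x τ) * ∏ i ∈ Finset.univ.erase τ, η₀ (x i)) := by
  have hF : HasFDerivAt (dampPsi η₀ 1 σ) (fderiv ℝ (dampPsi η₀ 1 σ) x)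
      (Function.update x τ (x τ)) := by
    rw [Function.update_eq_self]
    exact ((contDiff_dampPsi_one hC1 hone σ).differentiable one_ne_zero x).hasFDerivAt
  have h1 := hF.comp_hasDerivAt (x τ) (hasDerivAt_update x τ (x τ))
  have hσ := hasDerivAt_pi.mp (hasDerivAt_update x τ (x τ)) σ
  have h2 := (hσ.div (hasDerivAt_sum_sq_update x τ)
    (by rwa [Function.update_eq_self])).mul
    ((hasDerivAt_prod_update (hC1.differentiable one_ne_zero) x τ).const_sub 1)
  have h3 := h1.unique (h2.congr_of_eventuallyEq
    (Filter.Eventually.of_forall fun t => dampPsi_one η₀ σ _))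
  rw [h3]
  simp only [Pi.div_apply, Function.update_eq_self]
  ring

theorem abs_fderiv_dampPsi_one_le {S : ℕ} {η₀ : ℝ → ℝ} (hC1 : ContDiff ℝ 1 η₀)
    (hone : ∀ t : ℝ, |t| ≤ 1 / 2 → η₀ t = 1) (hbd : ∀ t : ℝ, |η₀ t| ≤ 1) {M : ℝ} (hM : 0 ≤ M)
    (hderiv : ∀ t, |deriv η₀ t| ≤ M / (1 + t ^ 2)) (σ τ : Fin S) (x : Fin S → ℝ) :
    |fderiv ℝ (dampPsi η₀ 1 σ) x (Pi.single τ 1)| ≤ (30 + 2 * M) / (1 + (x τ) ^ 2) := by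
  by_cases hx : ∑ i, (x i) ^ 2 < 1 / 4
  · rw [(dampPsi_one_eventuallyEq_zero hone σ hx).fderiv_eq]
    simp only [fderiv_fun_const, Pi.zero_apply, zero_apply, abs_zero]
    positivity
  have hx' := not_lt.mp hx
  have hR : 0 < ∑ i, (x i) ^ 2 := by linarith
  rw [fderiv_dampPsi_one hC1 hone σ τ hR.ne']
  have hxσ := sq_le_sum_sq x σ
  have hxτ := sq_le_sum_sq x τ
  have hquot := abs_div_sum_sq_le_two σ hx'
  have hprod := abs_one_sub_le_two (abs_prod_le_one Finset.univ fun i => hbd (x i))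
  have herase := abs_prod_le_one (Finset.univ.erase τ) fun i => hbd (x i)
  set R := ∑ i, (x i) ^ 2
  have hnum : |(Pi.single τ 1 : Fin S → ℝ) σ * R - x σ * (2 * x τ)| ≤ 3 * R := by
    have he : 0 ≤ (Pi.single τ 1 : Fin S → ℝ) σ ∧ (Pi.single τ 1 : Fin S → ℝ) σ ≤ 1 := by
      rw [Pi.single_apply]
      split_ifs <;> norm_num
    rw [abs_le]
    constructor <;>
      nlinarith [sq_nonneg (x σ - x τ), sq_nonneg (x σ + x τ), mul_nonneg he.1 hR.le,
        mul_nonneg (sub_nonneg.mpr he.2) hR.le]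
  have hrat : |((Pi.single τ 1 : Fin S → ℝ) σ * R - x σ * (2 * x τ)) / R ^ 2| ≤
      15 / (1 + (x τ) ^ 2) := by
    rw [abs_div, abs_of_pos (pow_pos hR 2), div_le_div_iff₀ (pow_pos hR 2) (by positivity)]
    calc _ ≤ 3 * R * (1 + (x τ) ^ 2) := by gcongr
      _ ≤ 3 * R * (5 * R) := by
        gcongr
        linarith
      _ = 15 * R ^ 2 := by ring
  calc _ ≤ _ := abs_sub _ _
    _ ≤ 15 / (1 + (x τ) ^ 2) * 2 + 2 * (M / (1 + (x τ) ^ 2) * 1) := by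
      simp only [abs_mul]
      have := hderiv (x τ)
      gcongr
    _ = _ := by ring

/-- Chain rule for the rescaling `s ↦ (δ i * s i)`. -/
theorem fderiv_dampPsi {S : ℕ} {η₀ : ℝ → ℝ} (hC1 : ContDiff ℝ 1 η₀)
    (hone : ∀ t : ℝ, |t| ≤ 1 / 2 → η₀ t = 1) (δ : Fin S → ℝ) (σ τ : Fin S) (s : Fin S → ℝ) :
    fderiv ℝ (dampPsi η₀ δ σ) s (Pi.single τ 1) =
      δ σ * (δ τ * fderiv ℝ (dampPsi η₀ 1 σ) (fun i => δ i * s i) (Pi.single τ 1)) := by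
  have hF := ((contDiff_dampPsi_one hC1 hone σ).differentiable one_ne_zero
    (fun i => δ i * s i)).hasFDerivAt
  have hL : HasFDerivAt (fun s : Fin S → ℝ => fun i => δ i * s i)
      (ContinuousLinearMap.pi fun i =>
        δ i • ContinuousLinearMap.proj (R := ℝ) (φ := fun _ : Fin S => ℝ) i) s :=
    hasFDerivAt_pi.mpr fun i => (hasFDerivAt_apply i s).const_mul (δ i)
  have hcomp : HasFDerivAt (fun s => δ σ * dampPsi η₀ 1 σ (fun i => δ i * s i)) _ s :=
    (hF.comp s hL).const_mul (δ σ)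
  rw [dampPsi_eq_mul_dampPsi_one, hcomp.fderiv]
  have hv : (ContinuousLinearMap.pi fun i =>
      δ i • ContinuousLinearMap.proj (R := ℝ) (φ := fun _ : Fin S => ℝ) i)
      (Pi.single τ 1 : Fin S → ℝ) = δ τ • (Pi.single τ 1 : Fin S → ℝ) := by
    ext i
    by_cases h : i = τ
    · subst h
      simp
    · simp [h]
  rw [smul_apply, ContinuousLinearMap.comp_apply, hv, map_smul]
  rfl

/-- The damping functions `ψ_σ` are `C¹` on all of `ℝ^S` and satisfy
`|ψ_σ(s)| ≤ C δ_σ` and `|∂_{σ'} ψ_σ(s)| ≤ C δ_σ δ_{σ'} / (1 + δ_{σ'}² s_{σ'}²)`, with `C`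
depending only on `S` and `η₀`. -/
theorem damping_function_estimates
    (S : ℕ) (hS : 1 ≤ S) (η₀ : ℝ → ℝ) (hC1 : ContDiff ℝ 1 η₀)
    (hsupp : Function.support η₀ ⊆ Set.Icc (-1 : ℝ) 1)
    (hone : ∀ t : ℝ, |t| ≤ 1 / 2 → η₀ t = 1) (hbd : ∀ t : ℝ, |η₀ t| ≤ 1) :
    (∀ δ : Fin S → ℝ, (∀ σ, 0 ≤ δ σ) → ∀ σ, ContDiff ℝ 1 (dampPsi η₀ δ σ)) ∧
    ∃ C : ℝ, ∀ δ : Fin S → ℝ, (∀ σ, 0 ≤ δ σ) → ∀ σ σ' : Fin S, ∀ s : Fin S → ℝ,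
      |dampPsi η₀ δ σ s| ≤ C * δ σ ∧
      |fderiv ℝ (dampPsi η₀ δ σ) s (Pi.single σ' 1)| ≤
        C * δ σ * δ σ' / (1 + (δ σ') ^ 2 * (s σ') ^ 2) := by
  obtain ⟨M, hM, hderiv⟩ := exists_abs_deriv_le_div hC1 hsupp
  refine ⟨fun δ _ σ => ?_, 30 + 2 * M, fun δ hδ σ τ s => ⟨?_, ?_⟩⟩
  · rw [dampPsi_eq_mul_dampPsi_one]
    exact contDiff_const.mul ((contDiff_dampPsi_one hC1 hone σ).comp
      (contDiff_pi.mpr fun i => contDiff_const.mul (contDiff_apply ℝ ℝ i)))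
  · rw [dampPsi_eq_mul_dampPsi_one, abs_mul, abs_of_nonneg (hδ σ), mul_comm]
    exact mul_le_mul_of_nonneg_right
      ((abs_dampPsi_one_le hone hbd σ _).trans (by linarith)) (hδ σ)
  · rw [fderiv_dampPsi hC1 hone, abs_mul, abs_mul, abs_of_nonneg (hδ σ), abs_of_nonneg (hδ τ)]
    have h := abs_fderiv_dampPsi_one_le hC1 hone hbd hM hderiv σ τ (fun i => δ i * s i)
    calc _ ≤ δ σ * (δ τ * ((30 + 2 * M) / (1 + (δ τ * s τ) ^ 2))) :=
          mul_le_mul_of_nonneg_left (mul_le_mul_of_nonneg_left h (hδ τ)) (hδ σ)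
      _ = _ := by
        rw [mul_pow]
        ring
end
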